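/- arXiv:1211.0865 — 3 statements merged into one kernel-verified Lean document; each statement's English description precedes it below -/
import Mathlib

section
/- (Type Preservation for full β-reduction) For all mixed terms m, m' and every type T: if m →a* T and m →b m', then m' →a* T. -/
/-- Simple types: `T ::= A | T₁ ⇒ T₂`. -/
inductive MTy : Type
  | base : MTy
  | arrow : MTy → MTy → MTy
  deriving DecidableEq

/-- Mixed terms (de Bruijn indices for variables):
`m ::= x | λx:T.m | m m' | a | f | A | T ⇒ m`. -/
inductive MTm : Type
  | var : ℕ → MTm
  | lam : MTy → MTm → MTm
  | app : MTm → MTm → MTm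
  | ca : MTm            -- the term constant `a`
  | cf : MTm            -- the term constant `f`
  | tyA : MTm           -- the base type `A` as a mixed term
  | arr : MTy → MTm → MTm  -- `T ⇒ m`
  deriving DecidableEq

namespace MTm

/-- The embedding of types into mixed terms. -/
def ofTy : MTy → MTm
  | .base => tyA
  | .arrow T1 T2 => arr T1 (ofTy T2)

/-- de Bruijn shifting of indices `≥ c` by `d`. -/
def shift (d c : ℕ) : MTm → MTm
  | var k => if k < c then var k else var (k + d)
  | lam T m => lam T (shift d (c + 1) m)
  | app m1 m2 => app (shift d c m1) (shift d c m2)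
  | ca => ca
  | cf => cf
  | tyA => tyA
  | arr T m => arr T (shift d c m)

/-- Capture-avoiding substitution `[s / j] m` (de Bruijn). -/
def subst (j : ℕ) (s : MTm) : MTm → MTm
  | var k => if k = j then s else if j < k then var (k - 1) else var k
  | lam T m => lam T (subst (j + 1) (shift 1 0 s) m)
  | app m1 m2 => app (subst j s m1) (subst j s m2)
  | ca => ca
  | cf => cf
  | tyA => tyA
  | arr T m => arr T (subst j s m)

/-- Mixed values: `u ::= λx:T.m | T ⇒ m | A | a | f`. -/
inductive IsValue : MTm → Prop
  | lam (T m) : IsValue (lam T m)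
  | arr (T m) : IsValue (arr T m)
  | tyA : IsValue tyA
  | ca : IsValue ca
  | cf : IsValue cf

/-- Abstract reduction `→a`, closed under arbitrary contexts. -/
inductive StepA : MTm → MTm → Prop
  | beta (T m) : StepA (app (arr T m) (ofTy T)) m
  | lamAbs (T m) : StepA (lam T m) (arr T (subst 0 (ofTy T) m))
  | cfAbs : StepA cf (arr .base tyA)
  | caAbs : StepA ca tyA
  | lamC {m m'} (T) : StepA m m' → StepA (lam T m) (lam T m')
  | appL {m1 m1'} (m2) : StepA m1 m1' → StepA (app m1 m2) (app m1' m2)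
  | appR {m2 m2'} (m1) : StepA m2 m2' → StepA (app m1 m2) (app m1 m2')
  | arrC {m m'} (T) : StepA m m' → StepA (arr T m) (arr T m')

/-- Concrete full β-reduction `→b`, closed under arbitrary contexts. -/
inductive StepB : MTm → MTm → Prop
  | beta (T m m') : StepB (app (lam T m) m') (subst 0 m' m)
  | fa : StepB (app cf ca) ca
  | lamC {m m'} (T) : StepB m m' → StepB (lam T m) (lam T m')
  | appL {m1 m1'} (m2) : StepB m1 m1' → StepB (app m1 m2) (app m1' m2)
  | appR {m2 m2'} (m1) : StepB m2 m2' → StepB (app m1 m2) (app m1 m2')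
  | arrC {m m'} (T) : StepB m m' → StepB (arr T m) (arr T m')

/-- Call-by-value reduction `→c`: redexes contracted inside
call-by-value evaluation contexts `E_c ::= * | E_c m | u E_c`. -/
inductive StepC : MTm → MTm → Prop
  | beta {u} (T m) : IsValue u → StepC (app (lam T m) u) (subst 0 u m)
  | fa : StepC (app cf ca) ca
  | appL {m1 m1'} (m2) : StepC m1 m1' → StepC (app m1 m2) (app m1' m2)
  | appR {u m2 m2'} : IsValue u → StepC m2 m2' → StepC (app u m2) (app u m2')

/-- Standard terms: mixed terms containing no type subterm. -/
inductive IsStandard : MTm → Prop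
  | var (x) : IsStandard (var x)
  | lam (T) {t} : IsStandard t → IsStandard (lam T t)
  | app {t1 t2} : IsStandard t1 → IsStandard t2 → IsStandard (app t1 t2)
  | ca : IsStandard ca
  | cf : IsStandard cf

/-- Standard values: `v ::= λx:T.t | a | f` with `t` standard. -/
inductive IsStdValue : MTm → Prop
  | lam (T) {t} : IsStandard t → IsStdValue (lam T t)
  | ca : IsStdValue ca
  | cf : IsStdValue cf

/-- All free de Bruijn indices are `< n`. -/
def ClosedUnder : ℕ → MTm → Prop
  | n, var k => k < n
  | n, lam _ m => ClosedUnder (n + 1) m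
  | n, app m1 m2 => ClosedUnder n m1 ∧ ClosedUnder n m2
  | _, ca => True
  | _, cf => True
  | _, tyA => True
  | n, arr _ m => ClosedUnder n m

/-- Quasi-stuck terms. -/
inductive QuasiStuck : MTm → Prop
  | val {u} : IsValue u → QuasiStuck u
  | app_ca {s} : QuasiStuck s → QuasiStuck (app ca s)
  | app_tyA {s} : QuasiStuck s → QuasiStuck (app tyA s)
  | app_cf {s} : QuasiStuck s → s ≠ ca → s ≠ tyA → QuasiStuck (app cf s)
  | app_AA {s} : QuasiStuck s → s ≠ ca → s ≠ tyA →
      QuasiStuck (app (arr .base tyA) s)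
  | app_lam {s} (T m) : QuasiStuck s → ¬ IsValue s → QuasiStuck (app (lam T m) s)
  | app_arr {s} (T m) : QuasiStuck s → ¬ IsValue s → QuasiStuck (app (arr T m) s)
  | app_app {s s'} : QuasiStuck s → QuasiStuck s' → ¬ IsValue s →
      QuasiStuck (app s s')

end MTm

namespace MTm

open Relation

theorem shift_ofTy (d c : ℕ) (T : MTy) : shift d c (ofTy T) = ofTy T := by
  induction T with
  | base => rfl
  | arrow T1 T2 _ ih => simp [ofTy, shift, ih]

theorem subst_ofTy (j : ℕ) (s : MTm) (T : MTy) : subst j s (ofTy T) = ofTy T := by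
  induction T with
  | base => rfl
  | arrow T1 T2 _ ih => simp [ofTy, subst, ih]

theorem shift_subst_ofTy_of_le (T : MTy) (m : MTm) :
    ∀ {j c : ℕ}, j ≤ c →
      shift 1 c (subst j (ofTy T) m) = subst j (ofTy T) (shift 1 (c + 1) m) := by
  induction m with
  | var k =>
    intro j c h
    simp only [subst, shift]
    split_ifs <;> simp only [shift, subst, shift_ofTy] <;> split_ifs <;>
      first | rfl | (exfalso; omega) | (congr 1; omega)
  | lam S m ih =>
    intro j c h
    simp only [subst, shift, shift_ofTy]
    rw [ih (Nat.succ_le_succ h)]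
  | app m1 m2 ih1 ih2 => intro j c h; simp only [subst, shift, ih1 h, ih2 h]
  | arr S m ih => intro j c h; simp only [subst, shift, ih h]
  | _ => intros; rfl

theorem shift_subst_ofTy_of_ge (T : MTy) (m : MTm) :
    ∀ {j c : ℕ}, c ≤ j →
      shift 1 c (subst j (ofTy T) m) = subst (j + 1) (ofTy T) (shift 1 c m) := by
  induction m with
  | var k =>
    intro j c h
    simp only [subst, shift]
    split_ifs <;> simp only [shift, subst, shift_ofTy] <;> split_ifs <;>
      first | rfl | (exfalso; omega) | (congr 1; omega)
  | lam S m ih =>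
    intro j c h
    simp only [subst, shift, shift_ofTy]
    rw [ih (Nat.succ_le_succ h)]
  | app m1 m2 ih1 ih2 => intro j c h; simp only [subst, shift, ih1 h, ih2 h]
  | arr S m ih => intro j c h; simp only [subst, shift, ih h]
  | _ => intros; rfl

theorem subst_ofTy_subst (T : MTy) (m : MTm) :
    ∀ {i j : ℕ} (s : MTm), i ≤ j →
      subst j (ofTy T) (subst i s m) =
        subst i (subst j (ofTy T) s) (subst (j + 1) (ofTy T) m) := by
  induction m with
  | var k =>
    intro i j s h
    simp only [subst]
    split_ifs <;> simp only [subst, subst_ofTy] <;> (try split_ifs) <;>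
      first | rfl | (exfalso; omega)
  | lam S m ih =>
    intro i j s h
    simp only [subst, shift_ofTy]
    rw [ih _ (Nat.succ_le_succ h), shift_subst_ofTy_of_ge T s (Nat.zero_le j)]
  | app m1 m2 ih1 ih2 => intro i j s h; simp only [subst, ih1 s h, ih2 s h]
  | arr S m ih => intro i j s h; simp only [subst, ih s h]
  | _ => intros; rfl

theorem StepA.shift {m m' : MTm} (h : StepA m m') :
    ∀ c, StepA (MTm.shift 1 c m) (MTm.shift 1 c m') := by
  induction h with
  | beta T m => intro c; simp only [MTm.shift, shift_ofTy]; exact .beta _ _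
  | lamAbs T m =>
    intro c
    simp only [MTm.shift, shift_subst_ofTy_of_le T m (Nat.zero_le c)]
    exact .lamAbs _ _
  | cfAbs => intro c; exact .cfAbs
  | caAbs => intro c; exact .caAbs
  | lamC T _ ih => intro c; exact .lamC T (ih _)
  | appL m2 _ ih => intro c; exact .appL _ (ih _)
  | appR m1 _ ih => intro c; exact .appR _ (ih _)
  | arrC T _ ih => intro c; exact .arrC T (ih _)

theorem StepA.subst_ofTy (S : MTy) {m m' : MTm} (h : StepA m m') :
    ∀ j, StepA (subst j (ofTy S) m) (subst j (ofTy S) m') := by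
  induction h with
  | beta T m => intro j; simp only [subst, MTm.subst_ofTy]; exact .beta _ _
  | lamAbs T m =>
    intro j
    simp only [subst, shift_ofTy, subst_ofTy_subst S m (ofTy T) (Nat.zero_le j),
      MTm.subst_ofTy]
    exact .lamAbs _ _
  | cfAbs => intro j; exact .cfAbs
  | caAbs => intro j; exact .caAbs
  | lamC T _ ih =>
    intro j
    simp only [subst, shift_ofTy]
    exact .lamC T (ih _)
  | appL m2 _ ih => intro j; exact .appL _ (ih _)
  | appR m1 _ ih => intro j; exact .appR _ (ih _)
  | arrC T _ ih => intro j; exact .arrC T (ih _)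

theorem StepB.subst_ofTy (S : MTy) {m m' : MTm} (h : StepB m m') :
    ∀ j, StepB (subst j (ofTy S) m) (subst j (ofTy S) m') := by
  induction h with
  | beta T m m' =>
    intro j
    simp only [subst, shift_ofTy, subst_ofTy_subst S m m' (Nat.zero_le j)]
    exact .beta _ _ _
  | fa => intro j; exact .fa
  | lamC T _ ih =>
    intro j
    simp only [subst, shift_ofTy]
    exact .lamC T (ih _)
  | appL m2 _ ih => intro j; exact .appL _ (ih _)
  | appR m1 _ ih => intro j; exact .appR _ (ih _)
  | arrC T _ ih => intro j; exact .arrC T (ih _)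


/-- Reducing the substituted term reduces the result of the substitution. -/
theorem reduces_subst (m : MTm) :
    ∀ {s s' : MTm} (j : ℕ), ReflTransGen StepA s s' →
      ReflTransGen StepA (subst j s m) (subst j s' m) := by
  induction m with
  | var k =>
    intro s s' j h
    simp only [subst]
    split_ifs
    · exact h
    · exact .refl
    · exact .refl
  | lam T m ih =>
    intro s s' j h
    exact (ih (j + 1) (h.lift (shift 1 0) fun _ _ h => h.shift 0)).lift (lam T)
      fun _ _ => StepA.lamC T
  | app m1 m2 ih1 ih2 =>
    intro s s' j h
    exact ((ih1 j h).lift (app · (subst j s m2)) fun _ _ => StepA.appL _).trans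
      ((ih2 j h).lift (app (subst j s' m1)) fun _ _ => StepA.appR _)
  | arr T m ih =>
    intro s s' j h
    exact (ih j h).lift (arr T) fun _ _ => StepA.arrC T
  | _ => intros; exact .refl

theorem arr_reduces {T : MTy} {m x : MTm} (h : ReflTransGen StepA (arr T m) x) :
    ∃ n, x = arr T n ∧ ReflTransGen StepA m n := by
  induction h with
  | refl => exact ⟨m, rfl, .refl⟩
  | tail _ hs ih =>
    obtain ⟨n, rfl, hn⟩ := ih
    cases hs with
    | arrC _ hs => exact ⟨_, rfl, hn.tail hs⟩

theorem lam_reduces {T : MTy} {m x : MTm} (h : ReflTransGen StepA (lam T m) x) :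
    (∃ n, x = lam T n ∧ ReflTransGen StepA m n) ∨
      ∃ n, x = arr T n ∧ ReflTransGen StepA (subst 0 (ofTy T) m) n := by
  induction h with
  | refl => exact .inl ⟨m, rfl, .refl⟩
  | tail _ hs ih =>
    rcases ih with ⟨n, rfl, hn⟩ | ⟨n, rfl, hn⟩
    · cases hs with
      | lamAbs => exact .inr ⟨_, rfl, hn.lift _ fun _ _ h => h.subst_ofTy T 0⟩
      | lamC _ hs => exact .inl ⟨_, rfl, hn.tail hs⟩
    · cases hs with
      | arrC _ hs => exact .inr ⟨_, rfl, hn.tail hs⟩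

theorem lam_reduces_arr {T S : MTy} {m n : MTm}
    (h : ReflTransGen StepA (lam T m) (arr S n)) :
    T = S ∧ ReflTransGen StepA (subst 0 (ofTy T) m) n := by
  rcases lam_reduces h with ⟨_, he, _⟩ | ⟨_, he, hn⟩
  · cases he
  · cases he; exact ⟨rfl, hn⟩

theorem app_reduces {m1 m2 x : MTm} (h : ReflTransGen StepA (app m1 m2) x) :
    (∃ n1 n2, x = app n1 n2 ∧ ReflTransGen StepA m1 n1 ∧ ReflTransGen StepA m2 n2) ∨
      ∃ S, ReflTransGen StepA m1 (arr S x) ∧ ReflTransGen StepA m2 (ofTy S) := by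
  induction h with
  | refl => exact .inl ⟨m1, m2, rfl, .refl, .refl⟩
  | tail _ hs ih =>
    rcases ih with ⟨n1, n2, rfl, h1, h2⟩ | ⟨S, h1, h2⟩
    · cases hs with
      | beta S => exact .inr ⟨S, h1, h2⟩
      | appL _ hs => exact .inl ⟨_, _, rfl, h1.tail hs, h2⟩
      | appR _ hs => exact .inl ⟨_, _, rfl, h1, h2.tail hs⟩
    · exact .inr ⟨S, h1.tail (.arrC S hs), h2⟩

theorem app_reduces_ofTy {m1 m2 : MTm} {T : MTy}
    (h : ReflTransGen StepA (app m1 m2) (ofTy T)) :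
    ∃ S, ReflTransGen StepA m1 (ofTy (.arrow S T)) ∧ ReflTransGen StepA m2 (ofTy S) := by
  rcases app_reduces h with ⟨_, _, he, _⟩ | h
  · cases T <;> cases he
  · exact h

theorem app_reduces_of_reduces {m1 m2 : MTm} {S T : MTy}
    (h1 : ReflTransGen StepA m1 (ofTy (.arrow S T))) (h2 : ReflTransGen StepA m2 (ofTy S)) :
    ReflTransGen StepA (app m1 m2) (ofTy T) :=
  ((h1.lift (app · m2) fun _ _ => StepA.appL _).trans
    (h2.lift (app (ofTy (.arrow S T))) fun _ _ => StepA.appR _)).tail (.beta S (ofTy T))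

theorem cf_reduces {x : MTm} (h : ReflTransGen StepA cf x) : x = cf ∨ x = arr .base tyA := by
  induction h with
  | refl => exact .inl rfl
  | tail _ hs ih =>
    rcases ih with rfl | rfl
    · cases hs; exact .inr rfl
    · cases hs with
      | arrC _ hs => cases hs

/-- The number of abstractions in a term. -/
def lamCount : MTm → ℕ
  | lam _ m => lamCount m + 1
  | app m1 m2 => lamCount m1 + lamCount m2
  | arr _ m => lamCount m
  | _ => 0

theorem lamCount_ofTy (T : MTy) : lamCount (ofTy T) = 0 := by
  induction T with
  | base => rfl
  | arrow T1 T2 _ ih => exact ih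

theorem lamCount_subst_ofTy (T : MTy) (m : MTm) :
    ∀ j, lamCount (subst j (ofTy T) m) = lamCount m := by
  induction m with
  | var k =>
    intro j
    simp only [subst]
    split_ifs
    · exact lamCount_ofTy T
    · rfl
    · rfl
  | lam S m ih => intro j; simp only [subst, shift_ofTy, lamCount, ih]
  | app m1 m2 ih1 ih2 => intro j; simp only [subst, lamCount, ih1, ih2]
  | arr S m ih => intro j; simp only [subst, lamCount, ih]
  | _ => intros; rfl

theorem reduces_ofTy_of_stepB (N : ℕ) :
    ∀ {m m' : MTm}, StepB m m' → lamCount m ≤ N → ∀ T : MTy,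
      ReflTransGen StepA m (ofTy T) → ReflTransGen StepA m' (ofTy T) := by
  induction N using Nat.strong_induction_on with | _ N ihN =>
  intro m m' hB
  induction hB with
  | beta S m s =>
    intro _ T h
    obtain ⟨S', h1, h2⟩ := app_reduces_ofTy h
    obtain ⟨rfl, hm⟩ := lam_reduces_arr h1
    exact (reduces_subst m 0 h2).trans hm
  | fa =>
    intro _ T h
    obtain ⟨S, h1, -⟩ := app_reduces_ofTy h
    rcases cf_reduces h1 with he | he
    · cases he
    · cases T <;> cases he
      exact .single .caAbs
  | lamC S hs =>
    intro hN T h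
    simp only [lamCount] at hN
    cases T with
    | base => rcases lam_reduces h with ⟨_, he, _⟩ | ⟨_, he, _⟩ <;> cases he
    | arrow S' T' =>
      obtain ⟨rfl, hm⟩ := lam_reduces_arr h
      have hm' := ihN _ hN (hs.subst_ofTy S 0) (lamCount_subst_ofTy S _ 0).le T' hm
      exact .head (.lamAbs _ _) (hm'.lift (arr S) fun _ _ => StepA.arrC S)
  | appL m2 _ ih =>
    intro hN T h
    obtain ⟨S, h1, h2⟩ := app_reduces_ofTy h
    exact app_reduces_of_reduces (ih ((Nat.le_add_right _ _).trans hN) _ h1) h2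
  | appR m1 _ ih =>
    intro hN T h
    obtain ⟨S, h1, h2⟩ := app_reduces_ofTy h
    exact app_reduces_of_reduces h1 (ih ((Nat.le_add_left _ _).trans hN) _ h2)
  | arrC S _ ih =>
    intro hN T h
    obtain ⟨n, he, hn⟩ := arr_reduces h
    cases T <;> cases he
    exact (ih hN _ hn).lift (arr S) fun _ _ => StepA.arrC S

end MTm

open Relation MTm

/-- Type Preservation for full β-reduction. -/
theorem type_preservation_beta (m m' : MTm) (T : MTy)
    (h1 : ReflTransGen StepA m (ofTy T)) (h2 : StepB m m') :
    ReflTransGen StepA m' (ofTy T) :=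
  reduces_ofTy_of_stepB _ h2 le_rfl T h1
end

section
/- (Confluence of Combined Reduction) Every typable mixed term is confluent with respect to →ab = →a ∪ →b: if m is typable and m →ab* m₁ and m →ab* m₂, then there exists m₃ with m₁ →ab* m₃ and m₂ →ab* m₃. -/
open Relation MTm

namespace MTm

/-- The type of an application, given the types of its function and its argument. -/
def appTy : Option MTy → Option MTy → Option MTy
  | some (.arrow T1 T2), some T => if T1 = T then some T2 else none
  | _, _ => none

/-- Type inference for mixed terms, where `T ⇒ m` has type `T ⇒ T'` whenever `m` has type `T'`. -/
def infer : List MTy → MTm → Option MTy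
  | Γ, var k => Γ[k]?
  | Γ, lam T m => (infer (T :: Γ) m).map (.arrow T)
  | Γ, app m1 m2 => appTy (infer Γ m1) (infer Γ m2)
  | _, ca => some .base
  | _, cf => some (.arrow .base .base)
  | _, tyA => some .base
  | Γ, arr T m => (infer Γ m).map (.arrow T)

theorem appTy_eq_some {o1 o2 : Option MTy} {T : MTy} (h : appTy o1 o2 = some T) :
    ∃ S, o1 = some (.arrow S T) ∧ o2 = some S := by
  unfold appTy at h
  split at h <;> grind

theorem infer_ofTy (Γ : List MTy) (T : MTy) : infer Γ (ofTy T) = some T := by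
  induction T with
  | base => rfl
  | arrow T1 T2 _ ih => simp [ofTy, infer, ih]

theorem infer_shift (T : MTy) (Γ₂ : List MTy) (m : MTm) (Γ₁ : List MTy) :
    infer (Γ₁ ++ T :: Γ₂) (shift 1 Γ₁.length m) = infer (Γ₁ ++ Γ₂) m := by
  induction m generalizing Γ₁ with
  | var k =>
    simp only [shift]
    split <;> simp only [infer] <;> grind
  | lam S m ih => simpa [shift, infer] using congrArg _ (ih (S :: Γ₁))
  | app m1 m2 ih1 ih2 => simp [shift, infer, ih1, ih2]
  | arr S m ih => simp [shift, infer, ih]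
  | _ => rfl

theorem infer_subst {S : MTy} {Γ₂ : List MTy} (m : MTm) {Γ₁ : List MTy} {s : MTm}
    (hs : infer (Γ₁ ++ Γ₂) s = some S) :
    infer (Γ₁ ++ Γ₂) (subst Γ₁.length s m) = infer (Γ₁ ++ S :: Γ₂) m := by
  induction m generalizing Γ₁ s with
  | var k =>
    simp only [subst]
    split
    · simp_all [infer]
    · split <;> simp only [infer] <;> grind
  | lam T m ih =>
    have hs' : infer (T :: Γ₁ ++ Γ₂) (shift 1 0 s) = some S :=
      (infer_shift T (Γ₁ ++ Γ₂) s []).trans hs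
    simpa [subst, infer] using congrArg _ (ih hs')
  | app m1 m2 ih1 ih2 => simp [subst, infer, ih1 hs, ih2 hs]
  | arr T m ih => simp [subst, infer, ih hs]
  | _ => rfl

theorem infer_subst_zero {S : MTy} {Γ : List MTy} (m : MTm) {s : MTm}
    (hs : infer Γ s = some S) : infer Γ (subst 0 s m) = infer (S :: Γ) m :=
  infer_subst (Γ₁ := []) m hs

theorem StepA.infer_eq {m m' : MTm} (h : StepA m m') (Γ : List MTy) :
    infer Γ m = infer Γ m' := by
  induction h generalizing Γ with
  | beta T m =>
    simp only [infer, infer_ofTy]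
    cases infer Γ m <;> simp [appTy]
  | lamAbs T m => simp [infer, infer_subst_zero m (infer_ofTy Γ T)]
  | cfAbs => rfl
  | caAbs => rfl
  | _ => simp_all [infer]

theorem StepB.infer_eq_some {m m' : MTm} (h : StepB m m') {Γ : List MTy} {T : MTy}
    (hm : infer Γ m = some T) : infer Γ m' = some T := by
  induction h generalizing Γ T with
  | beta S m m' =>
    obtain ⟨S', h1, h2⟩ := appTy_eq_some hm
    simp only [infer, Option.map_eq_some_iff, MTy.arrow.injEq] at h1
    obtain ⟨_, h, rfl, rfl⟩ := h1
    rw [infer_subst_zero m h2, h]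
  | fa => simpa [infer, appTy] using hm
  | appL m2 _ ih =>
    obtain ⟨S, h1, h2⟩ := appTy_eq_some hm
    simp [infer, ih h1, h2, appTy]
  | appR m1 _ ih =>
    obtain ⟨S, h1, h2⟩ := appTy_eq_some hm
    simp [infer, ih h2, h1, appTy]
  | lamC S _ ih | arrC S _ ih =>
    simp only [infer, Option.map_eq_some_iff] at hm ⊢
    obtain ⟨T', h, rfl⟩ := hm
    exact ⟨T', ih h, rfl⟩

/-- The number of nodes of a term that are not type constructors or variables. -/
def weight : MTm → ℕ
  | lam _ m => weight m + 1
  | app m1 m2 => weight m1 + weight m2 + 1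
  | arr _ m => weight m
  | ca => 1
  | cf => 1
  | var _ => 0
  | tyA => 0

theorem weight_ofTy (T : MTy) : weight (ofTy T) = 0 := by
  induction T with
  | base => rfl
  | arrow T1 T2 _ ih => simpa [ofTy, weight] using ih

theorem weight_shift (d c : ℕ) (m : MTm) : weight (shift d c m) = weight m := by
  induction m generalizing c with
  | var k => simp only [shift]; split <;> rfl
  | _ => simp_all [shift, weight]

theorem weight_subst (m : MTm) (j : ℕ) {s : MTm} (hs : weight s = 0) :
    weight (subst j s m) = weight m := by
  induction m generalizing j s with
  | var k => simp only [subst]; split_ifs <;> simp [weight, hs]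
  | lam T m ih => simp [subst, weight, ih (j + 1) ((weight_shift 1 0 s).trans hs)]
  | app m1 m2 ih1 ih2 => simp [subst, weight, ih1 j hs, ih2 j hs]
  | arr T m ih => simpa [subst, weight] using ih j hs
  | _ => rfl

open Relation in
theorem stepA_lift (f : MTm → MTm) (hf : ∀ m m', StepA m m' → StepA (f m) (f m'))
    {m m' : MTm} (h : ReflTransGen StepA m m') : ReflTransGen StepA (f m) (f m') := by
  induction h with
  | refl => exact .refl
  | tail _ hstep ih => exact ih.tail (hf _ _ hstep)

open Relation in
theorem reflTransGen_stepA_of_infer {m : MTm} {T : MTy} (h : infer [] m = some T) :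
    ReflTransGen StepA m (ofTy T) := by
  match m, h with
  | ca, h =>
    cases h
    exact .single .caAbs
  | cf, h =>
    cases h
    exact .single .cfAbs
  | tyA, h =>
    cases h
    exact .refl
  | var k, h => simp [infer] at h
  | app m1 m2, h =>
    obtain ⟨S, h1, h2⟩ := appTy_eq_some h
    have r1 := stepA_lift (app · m2) (fun _ _ => .appL m2) (reflTransGen_stepA_of_infer h1)
    have r2 := stepA_lift (app (ofTy (.arrow S T))) (fun _ _ => .appR _)
      (reflTransGen_stepA_of_infer h2)
    exact (r1.trans r2).tail (.beta S (ofTy T))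
  | lam S m, h =>
    rw [(StepA.lamAbs S m).infer_eq] at h
    simp only [infer, Option.map_eq_some_iff] at h
    obtain ⟨T', h', rfl⟩ := h
    exact .head (.lamAbs S m)
      (stepA_lift (arr S) (fun _ _ => .arrC S) (reflTransGen_stepA_of_infer h'))
  | arr S m, h =>
    simp only [infer, Option.map_eq_some_iff] at h
    obtain ⟨T', h', rfl⟩ := h
    exact stepA_lift (arr S) (fun _ _ => .arrC S) (reflTransGen_stepA_of_infer h')
termination_by (weight m, sizeOf m)
decreasing_by
  all_goals simp_wf
  all_goals simp only [weight, weight_subst _ _ (weight_ofTy _), Prod.lex_def]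
  all_goals simp

open Relation in
theorem infer_eq_some_of_reflTransGen {m m' : MTm} {Γ : List MTy} {T : MTy}
    (h : ReflTransGen (fun x y => StepA x y ∨ StepB x y) m m') (hm : infer Γ m = some T) :
    infer Γ m' = some T := by
  induction h with
  | refl => exact hm
  | tail _ hstep ih =>
    rcases hstep with hA | hB
    · rw [← hA.infer_eq, ih]
    · exact hB.infer_eq_some ih

end MTm

/-- Confluence of combined reduction `→ab = →a ∪ →b` on typable terms. -/
theorem combined_confluence_typable (m : MTm)
    (htyp : ∃ T : MTy, ReflTransGen StepA m (ofTy T)) :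
    ∀ m1 m2, ReflTransGen (fun x y => StepA x y ∨ StepB x y) m m1 →
      ReflTransGen (fun x y => StepA x y ∨ StepB x y) m m2 →
      ∃ m3, ReflTransGen (fun x y => StepA x y ∨ StepB x y) m1 m3 ∧
        ReflTransGen (fun x y => StepA x y ∨ StepB x y) m2 m3 := by
  obtain ⟨T, hT⟩ := htyp
  have hm : infer [] m = some T := by
    induction hT using ReflTransGen.head_induction_on with
    | refl => exact infer_ofTy [] T
    | head hstep _ ih => rw [hstep.infer_eq, ih]
  intro m1 m2 h1 h2
  have reduces {m' : MTm} (h : ReflTransGen (fun x y => StepA x y ∨ StepB x y) m m') :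
      ReflTransGen (fun x y => StepA x y ∨ StepB x y) m' (ofTy T) :=
    ReflTransGen.mono (fun _ _ => Or.inl) _ _
      (reflTransGen_stepA_of_infer (infer_eq_some_of_reflTransGen h hm))
  exact ⟨ofTy T, reduces h1, reduces h2⟩
end

section
/- (Generalized Progress) If a standard term t is closed, t →ca* T for some type T (where →ca = →c ∪ →a), and t is a normal form with respect to call-by-value reduction →c, then t is a standard value. -/
namespace MTm

/-- Mixed values with a functional shape. -/
inductive IsFun : MTm → Prop
  | lam (T m) : IsFun (lam T m)
  | arr (T m) : IsFun (arr T m)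
  | cf : IsFun cf

/-- Applications that can never reduce to a value. Unlike in `QuasiStuck`, the argument of a stuck
or base-typed head is arbitrary, since call-by-value reduction may leave it unevaluated. -/
inductive Stuck : MTm → Prop
  | app_ca (s) : Stuck (app ca s)
  | app_tyA (s) : Stuck (app tyA s)
  | app_cf_fun {s} : IsFun s → Stuck (app cf s)
  | app_arr_fun {s} : IsFun s → Stuck (app (arr .base tyA) s)
  | app_fun {u s} : IsFun u → Stuck s → Stuck (app u s)
  | app_left {s} (s') : Stuck s → Stuck (app s s')

theorem IsFun.stepA {m m' : MTm} (h : IsFun m) (hs : StepA m m') : IsFun m' := by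
  cases h <;> cases hs <;> constructor

theorem IsFun.not_stepC {m m' : MTm} (h : IsFun m) : ¬ StepC m m' := by
  intro hs
  cases h <;> cases hs

theorem IsFun.step {m m' : MTm} (h : IsFun m) (hs : StepC m m' ∨ StepA m m') : IsFun m' :=
  hs.elim (fun hc => absurd hc h.not_stepC) h.stepA

theorem IsFun.ne_tyA {m : MTm} (h : IsFun m) : m ≠ tyA := by
  cases h <;> simp

theorem Stuck.not_isValue {m : MTm} (h : Stuck m) : ¬ IsValue m := by
  intro hv
  cases h <;> cases hv

theorem isValue_ofTy (T : MTy) : IsValue (ofTy T) := by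
  cases T <;> constructor

/-- A step from an application is a contraction at the root or a step in one of its parts. -/
theorem step_app {m n r : MTm} (h : StepC (app m n) r ∨ StepA (app m n) r) :
    (∃ T b, m = lam T b ∧ IsValue n) ∨ (m = cf ∧ n = ca) ∨
    (∃ T b, m = arr T b ∧ n = ofTy T) ∨
    (∃ m', (StepC m m' ∨ StepA m m') ∧ r = app m' n) ∨
    (∃ n', (StepC n n' ∨ StepA n n') ∧ r = app m n') := by
  rcases h with h | h <;> cases h
  case inl.beta T b hv => exact .inl ⟨T, b, rfl, hv⟩
  case inl.fa => exact .inr (.inl ⟨rfl, rfl⟩)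
  case inl.appL m' h => exact .inr (.inr (.inr (.inl ⟨m', .inl h, rfl⟩)))
  case inl.appR n' _ h => exact .inr (.inr (.inr (.inr ⟨n', .inl h, rfl⟩)))
  case inr.beta T => exact .inr (.inr (.inl ⟨T, r, rfl, rfl⟩))
  case inr.appL m' h => exact .inr (.inr (.inr (.inl ⟨m', .inr h, rfl⟩)))
  case inr.appR n' h => exact .inr (.inr (.inr (.inr ⟨n', .inr h, rfl⟩)))

theorem Stuck.step {m m' : MTm} (h : Stuck m) (hs : StepC m m' ∨ StepA m m') : Stuck m' := by
  induction h generalizing m' with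
  | app_ca s =>
    rcases step_app hs with ⟨_, _, h, _⟩ | ⟨h, _⟩ | ⟨_, _, h, _⟩ | ⟨r, h | h, rfl⟩ | ⟨r, _, rfl⟩
    · cases h
    · cases h
    · cases h
    · cases h
    · cases h
      exact .app_tyA s
    · exact .app_ca r
  | app_tyA s =>
    rcases step_app hs with ⟨_, _, h, _⟩ | ⟨h, _⟩ | ⟨_, _, h, _⟩ | ⟨r, h | h, rfl⟩ | ⟨r, _, rfl⟩
    · cases h
    · cases h
    · cases h
    · cases h
    · cases h
    · exact .app_tyA r
  | app_cf_fun hf =>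
    rcases step_app hs with ⟨_, _, h, _⟩ | ⟨_, h⟩ | ⟨_, _, h, _⟩ | ⟨r, h | h, rfl⟩ | ⟨r, h, rfl⟩
    · cases h
    · subst h
      cases hf
    · cases h
    · cases h
    · cases h
      exact .app_arr_fun hf
    · exact .app_cf_fun (hf.step h)
  | app_arr_fun hf =>
    rcases step_app hs with ⟨_, _, h, _⟩ | ⟨h, _⟩ | ⟨_, _, h, h'⟩ | ⟨r, h | h, rfl⟩ | ⟨r, h, rfl⟩
    · cases h
    · cases h
    · cases h
      exact absurd h' hf.ne_tyA
    · cases h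
    · cases h with
      | arrC _ h => cases h
    · exact .app_arr_fun (hf.step h)
  | app_fun hf hst ih =>
    rcases step_app hs with ⟨_, _, _, h⟩ | ⟨_, rfl⟩ | ⟨T, _, _, rfl⟩ | ⟨r, h, rfl⟩ | ⟨r, h, rfl⟩
    · exact absurd h hst.not_isValue
    · exact absurd .ca hst.not_isValue
    · exact absurd (isValue_ofTy T) hst.not_isValue
    · exact .app_fun (hf.step h) hst
    · exact .app_fun hf (ih h)
  | app_left s' hst ih =>
    rcases step_app hs with ⟨T, b, rfl, _⟩ | ⟨rfl, _⟩ | ⟨T, b, rfl, _⟩ | ⟨r, h, rfl⟩ | ⟨r, _, rfl⟩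
    · exact absurd (.lam T b) hst.not_isValue
    · exact absurd .cf hst.not_isValue
    · exact absurd (.arr T b) hst.not_isValue
    · exact .app_left s' (ih h)
    · exact .app_left r hst

theorem Stuck.steps {m m' : MTm} (h : Stuck m)
    (hs : Relation.ReflTransGen (fun x y => StepC x y ∨ StepA x y) m m') : Stuck m' := by
  induction hs with
  | refl => exact h
  | tail _ hs ih => exact ih.step hs

theorem IsStdValue.isValue {m : MTm} (h : IsStdValue m) : IsValue m := by
  cases h <;> constructor

/-- Closed standard normal forms are standard values or stuck. -/
theorem IsStandard.isStdValue_or_stuck {t : MTm} (h : IsStandard t) (hc : ClosedUnder 0 t)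
    (hnf : ∀ u, ¬ StepC t u) : IsStdValue t ∨ Stuck t := by
  induction h with
  | var x => exact absurd hc (Nat.not_lt_zero x)
  | lam T h => exact .inl (.lam T h)
  | ca => exact .inl .ca
  | cf => exact .inl .cf
  | @app t₁ t₂ _ _ ih₁ ih₂ =>
    right
    rcases ih₁ hc.1 fun u h => hnf _ (.appL t₂ h) with hv₁ | hs₁
    · rcases ih₂ hc.2 fun u h => hnf _ (.appR hv₁.isValue h) with hv₂ | hs₂
      · cases hv₁ with
        | lam T _ => exact absurd (.beta T _ hv₂.isValue) (hnf _)
        | ca => exact .app_ca t₂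
        | cf =>
          cases hv₂ with
          | lam T _ => exact .app_cf_fun (.lam T _)
          | ca => exact absurd .fa (hnf _)
          | cf => exact .app_cf_fun .cf
      · cases hv₁ with
        | lam T _ => exact .app_fun (.lam T _) hs₂
        | ca => exact .app_ca t₂
        | cf => exact .app_fun .cf hs₂
    · exact .app_left t₂ hs₁

end MTm

open Relation MTm

/-- Generalized Progress: a closed, generalized-typable standard term in
`→c`-normal form is a standard value. -/
theorem generalized_progress (t : MTm) (T : MTy)
    (hstd : IsStandard t) (hclosed : ClosedUnder 0 t)
    (htyp : ReflTransGen (fun x y => StepC x y ∨ StepA x y) t (ofTy T))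
    (hnf : ∀ u, ¬ StepC t u) : IsStdValue t := by
  exact (hstd.isStdValue_or_stuck hclosed hnf).resolve_right fun h =>
    (h.steps htyp).not_isValue (isValue_ofTy T)
end
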